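/- For every dimension n ≥ 2 and every s ∈ (0,1) there exists a constant l̃ = l̃(n,s) > 0 such that every bounded convex set E ⊆ ℝⁿ with nonempty interior, |E| = ω_n and δ_s(E) ≤ 1 satisfies diam(E) ≤ l̃. -/

import Mathlib

open MeasureTheory Metric Bornology
open scoped ENNReal symmDiff

/-- The fractional `s`-perimeter of a set `E ⊆ ℝⁿ`:
`P_s(E) = ∫_E ∫_{Eᶜ} |x - y|^{-(n+s)} dx dy`. -/
noncomputable def fracPer (n : ℕ) (s : ℝ) (E : Set (EuclideanSpace ℝ (Fin n))) : ℝ≥0∞ :=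
  ∫⁻ x in E, ∫⁻ y in Eᶜ, ENNReal.ofReal (‖x - y‖ ^ (-((n : ℝ) + s)))

/-- The radius of the ball centered at the origin with the same volume as `E`. -/
noncomputable def matchRad (n : ℕ) (E : Set (EuclideanSpace ℝ (Fin n))) : ℝ :=
  ((volume E).toReal / (volume (ball (0 : EuclideanSpace ℝ (Fin n)) 1)).toReal) ^ ((1 : ℝ) / n)

/-- The `s`-isoperimetric deficit `δ_s(E) = (P_s(E) - P_s(B(m)))/P_s(B(m))`, where `B(m)` is the
ball centered at the origin with `|B(m)| = |E|`. -/
noncomputable def sDeficit (n : ℕ) (s : ℝ) (E : Set (EuclideanSpace ℝ (Fin n))) : ℝ :=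
  ((fracPer n s E).toReal
      - (fracPer n s (ball (0 : EuclideanSpace ℝ (Fin n)) (matchRad n E))).toReal)
    / (fracPer n s (ball (0 : EuclideanSpace ℝ (Fin n)) (matchRad n E))).toReal

/-- The barycenter `bar(E) = (1/|E|) ∫_E x dx`. -/
noncomputable def barycenter (n : ℕ) (E : Set (EuclideanSpace ℝ (Fin n))) :
    EuclideanSpace ℝ (Fin n) :=
  ((volume E).toReal)⁻¹ • ∫ x in E, x

/-- The barycentric asymmetry `λ₀(E) = |E ∆ (bar(E) + B(m))| / |E|`. -/
noncomputable def barAsym (n : ℕ) (E : Set (EuclideanSpace ℝ (Fin n))) : ℝ :=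
  (volume (E ∆ ball (barycenter n E) (matchRad n E))).toReal / (volume E).toReal

/-- The truncated kernel `|h|^{-(n+s)} min(1, C|h|)` is integrable on `ℝⁿ`. -/
theorem integrable_norm_rpow_mul_min {n : ℕ} (hn : 1 ≤ n) {s : ℝ} (hs : s ∈ Set.Ioo (0 : ℝ) 1)
    {C : ℝ} (hC : 0 ≤ C) :
    Integrable (fun h : EuclideanSpace ℝ (Fin n) ↦
      ‖h‖ ^ (-((n : ℝ) + s)) * min 1 (C * ‖h‖)) := by
  have : Nonempty (Fin n) := ⟨⟨0, hn⟩⟩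
  obtain ⟨hs0, hs1⟩ := hs
  rw [integrable_fun_norm_addHaar volume
    (f := fun y : ℝ ↦ y ^ (-((n : ℝ) + s)) * min 1 (C * y)), finrank_euclideanSpace_fin]
  have hpow : ∀ y : ℝ, 0 < y → y ^ (n - 1) * y ^ (-((n : ℝ) + s)) = y ^ (-1 - s) := by
    intro y hy
    rw [← Real.rpow_natCast, ← Real.rpow_add hy]
    congr 1
    push_cast [Nat.cast_sub hn]
    ring
  have hmeas : Measurable fun y : ℝ ↦
      y ^ (n - 1) • (y ^ (-((n : ℝ) + s)) * min 1 (C * y)) := by fun_prop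
  rw [← Set.Ioc_union_Ioi_eq_Ioi (zero_le_one (α := ℝ))]
  refine IntegrableOn.union ?_ ?_
  · have h1 : IntegrableOn (fun y : ℝ ↦ C * y ^ (-s)) (Set.Ioc 0 1) := by
      refine Integrable.const_mul ?_ C
      rw [← IntegrableOn, ← intervalIntegrable_iff_integrableOn_Ioc_of_le zero_le_one]
      exact intervalIntegral.intervalIntegrable_rpow' (by linarith)
    refine Integrable.mono' h1 hmeas.aestronglyMeasurable ?_
    refine (ae_restrict_iff' measurableSet_Ioc).2 (.of_forall fun y hy ↦ ?_)
    have hy0 : 0 < y := hy.1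
    rw [smul_eq_mul, ← mul_assoc, hpow y hy0, Real.norm_of_nonneg (by positivity)]
    calc y ^ (-1 - s) * min 1 (C * y) ≤ y ^ (-1 - s) * (C * y) := by
          gcongr; exact min_le_right _ _
      _ = C * (y ^ (-1 - s) * y ^ (1 : ℝ)) := by rw [Real.rpow_one]; ring
      _ = C * y ^ (-s) := by rw [← Real.rpow_add hy0]; ring_nf
  · have h1 : IntegrableOn (fun y : ℝ ↦ y ^ (-1 - s)) (Set.Ioi 1) :=
      integrableOn_Ioi_rpow_of_lt (by linarith) one_pos
    refine Integrable.mono' h1 hmeas.aestronglyMeasurable ?_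
    refine (ae_restrict_iff' measurableSet_Ioi).2 (.of_forall fun y hy ↦ ?_)
    have hy0 : 0 < y := one_pos.trans hy
    rw [smul_eq_mul, ← mul_assoc, hpow y hy0, Real.norm_of_nonneg (by positivity)]
    exact mul_le_of_le_one_right (by positivity) (min_le_left _ _)

theorem Convex.volume_closure_eq {n : ℕ} {E : Set (EuclideanSpace ℝ (Fin n))}
    (hE : Convex ℝ E) : volume (closure E) = volume E := by
  refine le_antisymm ?_ (measure_mono subset_closure)
  calc volume (closure E) ≤ volume (E ∪ frontier E) := by
        rw [← closure_eq_self_union_frontier]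
    _ ≤ volume E + volume (frontier E) := measure_union_le _ _
    _ = volume E := by rw [hE.addHaar_frontier volume, add_zero]

/-- The part of a convex set containing a ball of radius `r` that leaves the set under
translation by `h` has measure at most linear in `|h|`. -/
theorem Convex.volume_leaving_le {n : ℕ} {E : Set (EuclideanSpace ℝ (Fin n))}
    (hE : Convex ℝ E) (hb : IsBounded E) {c : EuclideanSpace ℝ (Fin n)} {r : ℝ} (hr : 0 < r)
    (hc : ball c r ⊆ E) (h : EuclideanSpace ℝ (Fin n)) :
    volume {x | x ∈ closure E ∧ x + h ∉ interior E}
      ≤ ENNReal.ofReal (min 1 (2 * n / r * ‖h‖)) * volume E := by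
  rcases eq_or_ne h 0 with rfl | hh
  · have : {x | x ∈ closure E ∧ x + 0 ∉ interior E} = frontier E := by
      ext x; simp only [add_zero]; rfl
    rw [this, hE.addHaar_frontier volume]
    exact zero_le
  have hh0 : 0 < ‖h‖ := norm_pos_iff.2 hh
  rw [ENNReal.ofReal_min, min_mul_of_nonneg _ _ zero_le, ENNReal.ofReal_one, one_mul]
  refine le_min ((measure_mono fun x hx ↦ hx.1).trans_eq hE.volume_closure_eq) ?_
  set t : ℝ := 2 * ‖h‖ / r with ht
  have ht0 : 0 < t := by positivity
  have htr : ‖h‖ < t * r := by rw [ht, div_mul_cancel₀ _ hr.ne']; linarith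
  have hnt : 2 * n / r * ‖h‖ = n * t := by rw [ht]; ring
  rw [hnt]
  have hfin : volume E ≠ ∞ := hb.measure_lt_top.ne
  rcases le_or_gt t 1 with ht1 | ht1
  · set K := AffineMap.homothety c (1 - t) '' E with hK
    have hKv : volume K = ENNReal.ofReal ((1 - t) ^ n) * volume E := by
      rw [hK, Measure.addHaar_image_homothety, finrank_euclideanSpace_fin,
        abs_of_nonneg (pow_nonneg (by linarith) _)]
    have hKm : NullMeasurableSet K := (hE.affine_image _).nullMeasurableSet _
    have hKE : K ⊆ closure E := by
      rintro _ ⟨e, he, rfl⟩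
      refine subset_closure ?_
      rw [AffineMap.homothety_apply, vsub_eq_sub, vadd_eq_add]
      have := hE he (hc (mem_ball_self hr)) (sub_nonneg.2 ht1) ht0.le (by ring)
      convert this using 1
      module
    have hsub : {x | x ∈ closure E ∧ x + h ∉ interior E} ⊆ closure E \ K := by
      rintro x ⟨hx, hxh⟩
      refine ⟨hx, ?_⟩
      rintro ⟨e, he, rfl⟩
      refine hxh ?_
      have hmem : c + t⁻¹ • h ∈ interior E := by
        refine interior_mono hc ?_
        rw [isOpen_ball.interior_eq, mem_ball_iff_norm, add_sub_cancel_left, norm_smul,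
          Real.norm_of_nonneg (by positivity), inv_mul_lt_iff₀ ht0]
        exact htr
      have := hE.combo_self_interior_mem_interior he hmem (sub_nonneg.2 ht1) ht0 (by ring)
      convert this using 1
      rw [AffineMap.homothety_apply, vsub_eq_sub, vadd_eq_add, smul_add, smul_inv_smul₀ ht0.ne']
      module
    calc volume {x | x ∈ closure E ∧ x + h ∉ interior E}
        ≤ volume (closure E \ K) := measure_mono hsub
      _ = volume E - ENNReal.ofReal ((1 - t) ^ n) * volume E := by
          rw [measure_sdiff hKE hKm, hE.volume_closure_eq, hKv]
          exact ne_top_of_le_ne_top (hE.volume_closure_eq ▸ hfin) (measure_mono hKE)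
      _ = (1 - ENNReal.ofReal ((1 - t) ^ n)) * volume E := by
          rw [ENNReal.sub_mul fun _ _ ↦ hfin, one_mul]
      _ ≤ ENNReal.ofReal (n * t) * volume E := by
          gcongr
          rw [← ENNReal.ofReal_one, ← ENNReal.ofReal_sub _ (pow_nonneg (by linarith) _)]
          refine ENNReal.ofReal_le_ofReal ?_
          have := one_add_mul_le_pow (a := -t) (by linarith) n
          rw [← sub_eq_add_neg] at this
          linarith
  · refine (measure_mono fun x hx ↦ hx.1).trans ?_
    rw [hE.volume_closure_eq]
    rcases Nat.eq_zero_or_pos n with rfl | hn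
    · exact absurd (Subsingleton.elim h 0) hh
    · have hn1 : (1 : ℝ) ≤ n := by exact_mod_cast hn
      exact le_mul_of_one_le_left zero_le (ENNReal.one_le_ofReal.2 (by nlinarith))

/-- Bounded convex sets with nonempty interior have finite fractional perimeter. -/
theorem fracPer_lt_top {n : ℕ} (hn : 1 ≤ n) {s : ℝ} (hs : s ∈ Set.Ioo (0 : ℝ) 1)
    {E : Set (EuclideanSpace ℝ (Fin n))} (hE : Convex ℝ E) (hb : IsBounded E)
    (hi : (interior E).Nonempty) : fracPer n s E < ∞ := by
  obtain ⟨c, hc⟩ := hi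
  obtain ⟨r, hr, hcr⟩ := Metric.isOpen_iff.1 isOpen_interior c hc
  set k : EuclideanSpace ℝ (Fin n) → ℝ≥0∞ :=
    fun h ↦ ENNReal.ofReal (‖h‖ ^ (-((n : ℝ) + s))) with hk
  have hkm : Measurable k := by fun_prop
  set A : Set (EuclideanSpace ℝ (Fin n) × EuclideanSpace ℝ (Fin n)) :=
    {p | p.1 ∈ closure E ∧ p.1 + p.2 ∉ interior E} with hA
  have hAm : MeasurableSet A :=
    (isClosed_closure.measurableSet.preimage measurable_fst).inter
      (isOpen_interior.measurableSet.compl.preimage (measurable_fst.add measurable_snd))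
  set C : ℝ := 2 * n / r
  have hC0 : 0 ≤ C := by positivity
  calc fracPer n s E
      ≤ ∫⁻ x in closure E, ∫⁻ y in (interior E)ᶜ, k (x - y) := by
        refine (lintegral_mono_set subset_closure).trans (lintegral_mono fun x ↦ ?_)
        exact lintegral_mono_set (Set.compl_subset_compl.2 interior_subset)
    _ = ∫⁻ x, ∫⁻ h, A.indicator (fun p ↦ k p.2) (x, h) := by
        rw [← lintegral_indicator isClosed_closure.measurableSet]
        refine lintegral_congr fun x ↦ ?_
        by_cases hx : x ∈ closure E
        · rw [Set.indicator_of_mem hx,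
            ← lintegral_indicator isOpen_interior.measurableSet.compl,
            ← lintegral_add_left_eq_self _ x]
          refine lintegral_congr fun h ↦ ?_
          have hk' : k (x - (x + h)) = k h := by simp [hk]
          by_cases hxh : x + h ∈ interior E
          · rw [Set.indicator_of_notMem (Set.notMem_compl_iff.2 hxh),
              Set.indicator_of_notMem fun hm : (x, h) ∈ A ↦ hm.2 hxh]
          · rw [Set.indicator_of_mem (Set.mem_compl hxh), hk',
              Set.indicator_of_mem (show (x, h) ∈ A from ⟨hx, hxh⟩)]
        · rw [Set.indicator_of_notMem hx]
          have : ∀ h, (x, h) ∉ A := fun h hm ↦ hx hm.1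
          simp [this]
    _ = ∫⁻ h, ∫⁻ x, A.indicator (fun p ↦ k p.2) (x, h) :=
        lintegral_lintegral_swap
          ((hkm.comp measurable_snd).indicator hAm).aemeasurable
    _ = ∫⁻ h, k h * volume {x | x ∈ closure E ∧ x + h ∉ interior E} := by
        refine lintegral_congr fun h ↦ ?_
        exact lintegral_indicator_const (measurable_prodMk_right hAm) (k h)
    _ ≤ ∫⁻ h, k h * (ENNReal.ofReal (min 1 (C * ‖h‖)) * volume E) := by
        gcongr with h
        exact hE.volume_leaving_le hb hr (hcr.trans interior_subset) h
    _ = (∫⁻ h : EuclideanSpace ℝ (Fin n),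
          ENNReal.ofReal (‖h‖ ^ (-((n : ℝ) + s)) * min 1 (C * ‖h‖))) * volume E := by
        rw [← lintegral_mul_const _ (by fun_prop)]
        refine lintegral_congr fun h ↦ ?_
        rw [ENNReal.ofReal_mul (by positivity), mul_assoc]
    _ < ∞ := ENNReal.mul_lt_top
        (integrable_norm_rpow_mul_min hn hs hC0).lintegral_lt_top hb.measure_lt_top

/-- If `E` occupies at most half of every ball of radius `ρ` centred in `E`, then its fractional
perimeter is bounded below. -/
theorem le_fracPer {n : ℕ} {s ρ : ℝ} (hs : 0 < s) (hρ : 0 < ρ)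
    {E : Set (EuclideanSpace ℝ (Fin n))} (hE : Convex ℝ E)
    (hhalf : ∀ x ∈ E, volume (E ∩ ball x ρ) ≤ volume (ball x ρ) / 2) :
    ENNReal.ofReal (ρ ^ (-s)) * (volume (ball (0 : EuclideanSpace ℝ (Fin n)) 1) / 2) * volume E
      ≤ fracPer n s E := by
  rw [← setLIntegral_const]
  refine lintegral_mono_ae ?_
  filter_upwards [ae_restrict_mem₀ (hE.nullMeasurableSet _)] with x hx
  have hball : volume (ball x ρ) ≠ ∞ := measure_ball_lt_top.ne
  have hout : volume (ball x ρ) / 2 ≤ volume (Eᶜ ∩ ball x ρ) := by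
    calc volume (ball x ρ) / 2 = volume (ball x ρ) - volume (ball x ρ) / 2 :=
          (ENNReal.sub_half hball).symm
      _ ≤ volume (ball x ρ) - volume (E ∩ ball x ρ) := tsub_le_tsub_left (hhalf x hx) _
      _ ≤ volume (ball x ρ \ (E ∩ ball x ρ)) := le_measure_sdiff
      _ ≤ volume (Eᶜ ∩ ball x ρ) := measure_mono fun y hy ↦ ⟨fun h ↦ hy.2 ⟨h, hy.1⟩, hy.1⟩
  calc ENNReal.ofReal (ρ ^ (-s)) * (volume (ball (0 : EuclideanSpace ℝ (Fin n)) 1) / 2)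
      = ENNReal.ofReal (ρ ^ (-((n : ℝ) + s))) * (volume (ball x ρ) / 2) := by
        rw [Measure.addHaar_ball_of_pos _ _ hρ, finrank_euclideanSpace_fin, mul_div_assoc,
          ← mul_assoc, ← ENNReal.ofReal_mul (by positivity), ← Real.rpow_natCast,
          ← Real.rpow_add hρ]
        ring_nf
    _ ≤ ENNReal.ofReal (ρ ^ (-((n : ℝ) + s))) * volume (Eᶜ ∩ ball x ρ) := by gcongr
    _ = ∫⁻ _ in Eᶜ ∩ ball x ρ, ENNReal.ofReal (ρ ^ (-((n : ℝ) + s))) := by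
        rw [setLIntegral_const]
    _ ≤ ∫⁻ y in Eᶜ ∩ ball x ρ, ENNReal.ofReal (‖x - y‖ ^ (-((n : ℝ) + s))) := by
        refine lintegral_mono_ae ?_
        filter_upwards [ae_restrict_mem₀ ((hE.nullMeasurableSet _).compl.inter
          measurableSet_ball.nullMeasurableSet)] with y hy
        refine ENNReal.ofReal_le_ofReal ?_
        have hpos : 0 < ‖x - y‖ := norm_pos_iff.2 (sub_ne_zero.2 fun h ↦ hy.1 (h ▸ hx))
        refine Real.rpow_le_rpow_of_nonpos hpos ?_ (by linarith [n.cast_nonneg (α := ℝ)])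
        rw [← dist_eq_norm, dist_comm]
        exact (mem_ball.1 hy.2).le
    _ ≤ ∫⁻ y in Eᶜ, ENNReal.ofReal (‖x - y‖ ^ (-((n : ℝ) + s))) :=
        lintegral_mono_set Set.inter_subset_left

/-- A convex set containing a point far from `x` contains many disjoint homothetic copies of its
part near `x`. -/
theorem Convex.card_mul_volume_inter_ball_le {n : ℕ} {E : Set (EuclideanSpace ℝ (Fin n))}
    (hE : Convex ℝ E) {x a : EuclideanSpace ℝ (Fin n)} (ha : a ∈ E) {ρ : ℝ} {N : ℕ}
    (hN : 0 < N) (hfar : 4 * N * ρ ≤ dist x a) :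
    N * (ENNReal.ofReal ((1 / 2) ^ n) * volume (E ∩ ball x ρ)) ≤ volume E := by
  have hN0 : (0 : ℝ) < N := by exact_mod_cast hN
  set u : ℕ → ℝ := fun j ↦ j / (2 * N) with hu
  set z : ℕ → EuclideanSpace ℝ (Fin n) := fun j ↦ AffineMap.homothety a (1 - u j) x with hz
  have hu1 : ∀ j ∈ Finset.range N, 0 ≤ u j ∧ u j ≤ 1 / 2 := by
    intro j hj
    have hj' : (j : ℝ) ≤ N := by exact_mod_cast (Finset.mem_range.1 hj).le
    refine ⟨by positivity, ?_⟩
    rw [hu, div_le_div_iff₀ (by positivity) two_pos]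
    linarith
  have hdist : ∀ i j, dist (z i) (z j) = |u i - u j| * dist x a := by
    intro i j
    rw [dist_eq_norm, dist_eq_norm, ← Real.norm_eq_abs, ← norm_neg, ← norm_smul]
    congr 1
    simp only [hz, AffineMap.homothety_apply, vsub_eq_sub, vadd_eq_add]
    module
  have hdisj : (Finset.range N : Set ℕ).PairwiseDisjoint fun j ↦ ball (z j) ρ := by
    intro i _ j _ hij
    refine ball_disjoint_ball ?_
    rw [hdist]
    have h1 : (1 : ℝ) ≤ |(i : ℝ) - j| := by
      have : (1 : ℤ) ≤ |(i : ℤ) - j| := Int.one_le_abs (by omega)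
      exact_mod_cast this
    have h2 : 1 / (2 * N) ≤ |u i - u j| := by
      rw [hu, ← sub_div, abs_div, abs_of_pos (by positivity : (0 : ℝ) < 2 * N)]
      gcongr
    calc ρ + ρ = 1 / (2 * N) * (4 * N * ρ) := by field_simp; ring
      _ ≤ 1 / (2 * N) * dist x a := by gcongr
      _ ≤ |u i - u j| * dist x a := by gcongr
  calc N * (ENNReal.ofReal ((1 / 2) ^ n) * volume (E ∩ ball x ρ))
      = ∑ _j ∈ Finset.range N, ENNReal.ofReal ((1 / 2) ^ n) * volume (E ∩ ball x ρ) := by simp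
    _ ≤ ∑ j ∈ Finset.range N, volume.restrict E (ball (z j) ρ) := by
        refine Finset.sum_le_sum fun j hj ↦ ?_
        obtain ⟨h0, h1⟩ := hu1 j hj
        calc ENNReal.ofReal ((1 / 2) ^ n) * volume (E ∩ ball x ρ)
            ≤ ENNReal.ofReal |(1 - u j) ^ n| * volume (E ∩ ball x ρ) := by
              rw [abs_of_nonneg (pow_nonneg (by linarith) _)]
              gcongr
              linarith
          _ = volume (AffineMap.homothety a (1 - u j) '' (E ∩ ball x ρ)) := by
              rw [Measure.addHaar_image_homothety, finrank_euclideanSpace_fin]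
          _ ≤ volume (ball (z j) ρ ∩ E) := by
              refine measure_mono ?_
              rintro _ ⟨y, ⟨hyE, hy⟩, rfl⟩
              constructor
              · have : dist (AffineMap.homothety a (1 - u j) y) (z j) = (1 - u j) * dist y x := by
                  rw [dist_eq_norm, dist_eq_norm,
                    ← Real.norm_of_nonneg (by linarith : 0 ≤ 1 - u j), ← norm_smul]
                  rw [Real.norm_of_nonneg (by linarith : 0 ≤ 1 - u j)]
                  congr 1
                  simp only [hz, AffineMap.homothety_apply, vsub_eq_sub, vadd_eq_add]
                  module
                rw [mem_ball, this]
                exact (mul_le_of_le_one_left dist_nonneg (by linarith)).trans_lt hy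
              · rw [AffineMap.homothety_apply, vsub_eq_sub, vadd_eq_add]
                have := hE hyE ha (by linarith : 0 ≤ 1 - u j) h0 (by ring)
                convert this using 1
                module
          _ = volume.restrict E (ball (z j) ρ) := (Measure.restrict_apply measurableSet_ball).symm
    _ = volume.restrict E (⋃ j ∈ Finset.range N, ball (z j) ρ) :=
        (measure_biUnion_finset hdisj fun _ _ ↦ measurableSet_ball).symm
    _ ≤ volume.restrict E Set.univ := measure_mono (Set.subset_univ _)
    _ = volume E := Measure.restrict_apply_univ _

theorem fracPer_ball_pos {n : ℕ} (hn : 1 ≤ n) {s : ℝ} (hs : 0 < s) :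
    0 < fracPer n s (ball 0 1) := by
  set V := volume (ball (0 : EuclideanSpace ℝ (Fin n)) 1)
  have hV0 : V ≠ 0 := (measure_ball_pos volume _ one_pos).ne'
  refine lt_of_lt_of_le ?_ (le_fracPer hs two_pos (convex_ball 0 1) fun x _ ↦ ?_)
  · refine pos_iff_ne_zero.2 (mul_ne_zero (mul_ne_zero ?_ ?_) hV0)
    · exact (ENNReal.ofReal_pos.2 (by positivity)).ne'
    · exact (ENNReal.half_pos hV0).ne'
  · rw [ENNReal.le_div_iff_mul_le (by simp) (by simp),
      Measure.addHaar_ball_of_pos _ _ two_pos, finrank_euclideanSpace_fin, mul_comm]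
    gcongr
    · rw [← ENNReal.ofReal_ofNat 2]
      exact ENNReal.ofReal_le_ofReal (le_self_pow₀ one_le_two (by omega))
    · exact Set.inter_subset_left

theorem matchRad_eq_one {n : ℕ} {E : Set (EuclideanSpace ℝ (Fin n))}
    (hE : volume E = volume (ball (0 : EuclideanSpace ℝ (Fin n)) 1)) : matchRad n E = 1 := by
  have h : (volume (ball (0 : EuclideanSpace ℝ (Fin n)) 1)).toReal ≠ 0 :=
    (ENNReal.toReal_pos (measure_ball_pos volume _ one_pos).ne' measure_ball_lt_top.ne).ne'
  rw [matchRad, hE, div_self h, Real.one_rpow]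

/-- There is `l̃ = l̃(n,s) > 0` such that every bounded convex set `E ⊆ ℝⁿ` with nonempty
interior, `|E| = ω_n` and `δ_s(E) ≤ 1` satisfies `diam(E) ≤ l̃`. -/
theorem diam_bounded_of_small_fractional_deficit
    (n : ℕ) (hn : 2 ≤ n) (s : ℝ) (hs : s ∈ Set.Ioo (0 : ℝ) 1) :
    ∃ L : ℝ, 0 < L ∧ ∀ E : Set (EuclideanSpace ℝ (Fin n)),
      Convex ℝ E → IsBounded E → (interior E).Nonempty →
      volume E = volume (ball (0 : EuclideanSpace ℝ (Fin n)) 1) →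
      sDeficit n s E ≤ 1 →
      Metric.diam E ≤ L := by
  have hn1 : 1 ≤ n := by omega
  set V := volume (ball (0 : EuclideanSpace ℝ (Fin n)) 1) with hV
  have hV0 : V ≠ 0 := (measure_ball_pos volume _ one_pos).ne'
  have hVtop : V ≠ ∞ := measure_ball_lt_top.ne
  have hvpos : 0 < V.toReal := ENNReal.toReal_pos hV0 hVtop
  set P := fracPer n s (ball 0 1)
  have hPtop : P < ∞ := fracPer_lt_top hn1 hs (convex_ball 0 1) isBounded_ball
    (by rw [isOpen_ball.interior_eq]; exact ⟨0, mem_ball_self one_pos⟩)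
  have hppos : 0 < P.toReal := ENNReal.toReal_pos (fracPer_ball_pos hn1 hs.1).ne' hPtop.ne
  obtain ⟨ρ, hρP, hρ⟩ : ∃ ρ : ℝ, 2 * P.toReal / (V.toReal / 2 * V.toReal) < ρ ^ (-s) ∧ 0 < ρ :=
    (((tendsto_rpow_neg_nhdsGT_zero (neg_lt_zero.2 hs.1)).eventually_gt_atTop _).and
      self_mem_nhdsWithin).exists
  rw [div_lt_iff₀ (by positivity)] at hρP
  obtain ⟨N, hN⟩ := exists_nat_gt (2 / ((1 / 2) ^ n * ρ ^ n))
  have hNr : (0 : ℝ) < N := lt_of_le_of_lt (by positivity) hN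
  have hN0 : 0 < N := by exact_mod_cast hNr
  rw [div_lt_iff₀ (by positivity)] at hN
  refine ⟨8 * N * ρ, by positivity, fun E hE hb hi hvol hdef ↦ ?_⟩
  have hPE : fracPer n s E < ∞ := fracPer_lt_top hn1 hs hE hb hi
  rw [sDeficit, matchRad_eq_one hvol, div_le_one hppos] at hdef
  by_contra! hdiam
  obtain ⟨a, ha, b, hab, hlt⟩ : ∃ a ∈ E, ∃ b ∈ E, 8 * N * ρ < dist a b := by
    by_contra! hall
    exact hdiam.not_ge (diam_le_of_forall_dist_le (by positivity) hall)
  have hlow := le_fracPer hs.1 hρ hE fun x hx ↦ by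
    obtain ⟨c, hc, hfar⟩ : ∃ c ∈ E, 4 * N * ρ ≤ dist x c := by
      by_contra! hall
      have := dist_triangle_left a b x
      linarith [hall a ha, hall b hab]
    by_contra! hbig
    have hcard := hE.card_mul_volume_inter_ball_le hc hN0 hfar
    have hle := calc
      N * (ENNReal.ofReal ((1 / 2) ^ n) * (volume (ball x ρ) / 2))
        ≤ N * (ENNReal.ofReal ((1 / 2) ^ n) * volume (E ∩ ball x ρ)) := by gcongr
      _ ≤ V := hcard.trans_eq hvol
    rw [Measure.addHaar_ball_of_pos _ _ hρ, finrank_euclideanSpace_fin, ← hV] at hle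
    have hreal := ENNReal.toReal_mono hVtop hle
    simp only [ENNReal.toReal_mul, ENNReal.toReal_div, ENNReal.toReal_natCast,
      ENNReal.toReal_ofNat, ENNReal.toReal_ofReal (pow_nonneg hρ.le n),
      ENNReal.toReal_ofReal (by positivity : (0 : ℝ) ≤ (1 / 2) ^ n)] at hreal
    nlinarith
  rw [hvol, ← hV] at hlow
  have hreal := ENNReal.toReal_mono hPE.ne hlow
  simp only [ENNReal.toReal_mul, ENNReal.toReal_div, ENNReal.toReal_ofNat,
    ENNReal.toReal_ofReal (Real.rpow_nonneg hρ.le _)] at hreal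
  linarith
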